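/- arXiv:1509.01371 — 3 statements merged into one kernel-verified Lean document; each statement's English description precedes it below -/
import Mathlib

section
/- Let m be even. For every a ∈ F_r^* with Tr(a^{-1}) ≠ 0 and every ρ ∈ F_p^*, the number N_a(ρ) of x ∈ F_r^* with Tr(x) = 0 and Tr(ax²) = ρ equals p^{m-2} − (-1)^{((p-1)/2)·((m+2)/2)} · η(a) · η̄(Tr(a^{-1})) · η̄(ρ) · p^{(m-2)/2}. -/
theorem Odd.sq_div_two {q : ℕ} (hq : Odd q) : q ^ 2 / 2 = (q - 1) * ((q + 1) / 2) := by
  obtain ⟨k, rfl⟩ := hq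
  have e1 : (2 * k + 1 + 1) / 2 = k + 1 := by omega
  have e2 : (2 * k + 1) ^ 2 = 2 * (2 * k * (k + 1)) + 1 := by ring
  rw [e1, e2, Nat.add_sub_cancel]
  omega

open Finset in
/-- Completing the square: a nontrivial additive character summed over a quadratic polynomial. -/
theorem AddChar.sum_quadratic_eq_gaussSum {F R : Type*} [Field F] [Fintype F] [DecidableEq F]
    [CommRing R] [IsDomain R] (hF : ringChar F ≠ 2) {ψ : AddChar F R} (hψ : ψ ≠ 1)
    {a : F} (ha : a ≠ 0) (b : F) :
    ∑ x, ψ (a * x ^ 2 + b * x) =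
      ψ (-(b ^ 2 / (4 * a))) * (quadraticChar F a *
        gaussSum ((quadraticChar F).ringHomComp (Int.castRingHom R)) ψ) := by
  have h2 : (2 : F) ≠ 0 := Ring.two_ne_zero hF
  have h4 : (4 : F) ≠ 0 := by
    rw [show (4 : F) = 2 * 2 by norm_num]
    exact mul_ne_zero h2 h2
  have hsq (φ : AddChar F R) (hφ : φ ≠ 1) :
      ∑ x, φ (x ^ 2) = gaussSum ((quadraticChar F).ringHomComp (Int.castRingHom R)) φ := by
    have hfib (y : F) : ∑ x with x ^ 2 = y, φ (x ^ 2) = ((quadraticChar F y : R) + 1) * φ y := by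
      rw [sum_congr rfl fun x hx => by rw [(mem_filter.mp hx).2], sum_const, nsmul_eq_mul]
      have h := quadraticChar_card_sqrts hF y
      rw [Set.toFinset_ofPred] at h
      rw [← Int.cast_natCast, h]
      push_cast
      rfl
    rw [← sum_fiberwise univ (fun x => x ^ 2), sum_congr rfl fun y _ => hfib y]
    simp [add_mul, sum_add_distrib, AddChar.sum_eq_zero_of_ne_one hφ, gaussSum]
  have hχ : (quadraticChar F a : R) * quadraticChar F a = 1 := by
    rw [← Int.cast_mul, ← pow_two, quadraticChar_sq_one ha, Int.cast_one]
  have hshift := gaussSum_mulShift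
    ((quadraticChar F).ringHomComp (Int.castRingHom R)) ψ (Units.mk0 a ha)
  rw [← hshift, MulChar.ringHomComp_apply, Units.val_mk0, eq_intCast,
    ← mul_assoc _ _ (gaussSum _ _), hχ, one_mul,
    ← hsq _ (AddChar.IsPrimitive.of_ne_one hψ ha), mul_sum]
  refine Fintype.sum_equiv (Equiv.addRight (b / (2 * a))) _ _ fun x => ?_
  rw [AddChar.mulShift_apply, ← AddChar.map_add_eq_mul, Equiv.coe_addRight]
  congr 1
  field_simp
  ring

open Finset in
/-- The quadratic Gauss sum of a quadratic extension `F / K`, for an additive character lifted from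
`K` along the trace. -/
theorem gaussSum_quadraticChar_of_finrank_eq_two {K F R : Type*} [Field K] [Fintype K] [Field F]
    [Fintype F] [DecidableEq F] [Algebra K F] [CommRing R] [IsDomain R] [CharZero R]
    (hF : ringChar F ≠ 2) (hKF : Module.finrank K F = 2) {ψ : AddChar K R} (hψ : ψ ≠ 1) :
    gaussSum ((quadraticChar F).ringHomComp (Int.castRingHom R))
        (ψ.compAddMonoidHom (Algebra.trace K F).toAddMonoidHom) =
      (-1) ^ ((Fintype.card K + 1) / 2) * Fintype.card K := by
  classical
  set q := Fintype.card K with hq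
  have hcard : Fintype.card F = q ^ 2 := by rw [Module.card_eq_pow_finrank (K := K), hKF]
  have hq1 : 1 < q := Fintype.one_lt_card
  have hqodd : q % 2 = 1 := by
    have := FiniteField.odd_card_of_char_ne_two hF
    rw [hcard, Nat.pow_mod] at this
    rcases Nat.mod_two_eq_zero_or_one q with h | h <;> simp_all
  have hhalf : Fintype.card F / 2 = (q - 1) * ((q + 1) / 2) := by
    rw [hcard, (Nat.odd_iff.mpr hqodd).sq_div_two]
  have hbase (c : K) (hc : c ≠ 0) : quadraticChar F (algebraMap K F c) = 1 := by
    rw [quadraticChar_eq_pow_of_char_ne_two hF (by simpa using hc), hhalf, pow_mul, ← map_pow,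
      FiniteField.pow_card_sub_one_eq_one c hc]
    simp
  have hker (x : F) (hx : x ≠ 0) (htr : Algebra.trace K F x = 0) :
      quadraticChar F x = (-1) ^ ((q + 1) / 2) := by
    have h := FiniteField.algebraMap_trace_eq_sum_pow K F x
    rw [htr, map_zero, hKF, Nat.card_eq_fintype_card, ← hq] at h
    simp only [sum_range_succ, range_zero, sum_empty, pow_zero, pow_one, zero_add] at h
    have hx1 : x ^ (q - 1) = -1 := by
      apply mul_right_cancel₀ hx
      rw [← pow_succ, Nat.sub_add_cancel hq1.le]
      linear_combination -h
    have h1 : (-1 : F) ≠ 1 := Ring.neg_one_ne_one_of_char_ne_two hF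
    rw [quadraticChar_eq_pow_of_char_ne_two hF hx, hhalf, pow_mul, hx1]
    rcases neg_one_pow_eq_or F ((q + 1) / 2) with h | h
    · have he : Even ((q + 1) / 2) := by
        by_contra ho
        rw [(Nat.not_even_iff_odd.mp ho).neg_one_pow] at h
        exact h1 h
      simp [he.neg_one_pow]
    · have ho : Odd ((q + 1) / 2) := by
        by_contra he
        rw [(Nat.not_odd_iff_even.mp he).neg_one_pow] at h
        exact h1 h.symm
      simp [ho.neg_one_pow, h1]
  have hkercard : #{x : F | Algebra.trace K F x = 0} = q := by
    have hs := Algebra.trace_surjective K F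
    have h := LinearMap.finrank_range_add_finrank_ker (Algebra.trace K F)
    rw [LinearMap.range_eq_top.mpr hs, finrank_top, Module.finrank_self, hKF] at h
    have h' : Module.finrank K (LinearMap.ker (Algebra.trace K F)) = 1 := by omega
    have hc := Module.card_eq_pow_finrank (K := K) (V := LinearMap.ker (Algebra.trace K F))
    rw [h', pow_one, ← hq] at hc
    rw [← hc, Fintype.card_subtype]
    simp
  set χ := (quadraticChar F).ringHomComp (Int.castRingHom R) with hχ
  set Ψ := ψ.compAddMonoidHom (Algebra.trace K F).toAddMonoidHom with hΨ
  have hscale (c : K) (hc : c ≠ 0) :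
      ∑ x, χ x * ψ (c * Algebra.trace K F x) = gaussSum χ Ψ := by
    have h := gaussSum_mulShift χ Ψ (Units.mk0 (algebraMap K F c) (by simpa using hc))
    rw [← h]
    simp [hχ, hΨ, hbase c hc, gaussSum, ← Algebra.smul_def]
  have hχ0 : ∑ x, χ x = 0 := by
    simp only [hχ, MulChar.ringHomComp_apply, eq_intCast, ← Int.cast_sum,
      quadraticChar_sum_zero hF, Int.cast_zero]
  have hsum : ∑ c : K, ∑ x, χ x * ψ (c * Algebra.trace K F x) = (q - 1) * gaussSum χ Ψ := by
    rw [← add_sum_erase _ _ (mem_univ (0 : K)), sum_congr rfl fun c hc =>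
      hscale c (ne_of_mem_erase hc), sum_const, card_erase_of_mem (mem_univ _), card_univ, ← hq]
    simp [hχ0, Nat.cast_sub hq1.le]
  have hsum' : ∑ c : K, ∑ x, χ x * ψ (c * Algebra.trace K F x) =
      (q - 1) * ((-1) ^ ((q + 1) / 2) * q) := by
    rw [sum_comm]
    simp_rw [← mul_sum, AddChar.sum_mulShift _ (AddChar.IsPrimitive.of_ne_one hψ)]
    have h0 : (0 : F) ∈ ({x : F | Algebra.trace K F x = 0} : Finset F) := by simp
    simp only [Nat.cast_ite, Nat.cast_zero, mul_ite, mul_zero]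
    rw [← sum_filter, ← add_sum_erase _ _ h0,
      sum_congr rfl (g := fun _ => (-1) ^ ((q + 1) / 2) * (q : R)),
      sum_const, card_erase_of_mem h0, hkercard]
    · simp [hχ, Nat.cast_sub hq1.le]
    · intro x hx
      simp only [mem_erase, mem_filter, mem_univ, true_and] at hx
      simp [hχ, hker x hx.1 hx.2, hq]
  have hq1' : (q : R) - 1 ≠ 0 := by
    rw [sub_ne_zero]
    exact_mod_cast hq1.ne'
  exact mul_left_cancel₀ hq1' (hsum.symm.trans hsum')

/-- The quadratic Gauss sum of a finite field of even degree over its prime field. -/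
theorem gaussSum_quadraticChar_of_card_eq_pow_even {p n : ℕ} [Fact p.Prime] (hp : p ≠ 2)
    (hn : n ≠ 0) {F R : Type*} [Field F] [Fintype F] [DecidableEq F] [Algebra (ZMod p) F]
    [CommRing R] [IsDomain R] [CharZero R] (hF : Fintype.card F = p ^ (2 * n))
    {ψ : AddChar (ZMod p) R} (hψ : ψ ≠ 1) :
    gaussSum ((quadraticChar F).ringHomComp (Int.castRingHom R))
        (ψ.compAddMonoidHom (Algebra.trace (ZMod p) F).toAddMonoidHom) =
      (-1) ^ ((p ^ n + 1) / 2) * p ^ n := by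
  have hp1 : 1 < p := (Fact.out : p.Prime).one_lt
  have hfin : Module.finrank (ZMod p) F = 2 * n := by
    apply Nat.pow_right_injective hp1
    simp only
    rw [FiniteField.pow_finrank_eq_card, hF]
  have hKfin := GaloisField.finrank p hn
  have : Fintype (GaloisField p n) := Fintype.ofFinite _
  have hK : Fintype.card (GaloisField p n) = p ^ n := by
    rw [Fintype.card_eq_nat_card, GaloisField.card p n hn]
  obtain ⟨f⟩ := FiniteField.nonempty_algHom_of_finrank_dvd (F := ZMod p) (K := GaloisField p n)
    (L := F) (by rw [hKfin, hfin]; exact dvd_mul_left _ _)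
  algebraize [f.toRingHom]
  have : IsScalarTower (ZMod p) (GaloisField p n) F :=
    IsScalarTower.of_algebraMap_eq fun x => (f.commutes x).symm
  have h2 : Module.finrank (GaloisField p n) F = 2 := by
    have := Module.finrank_mul_finrank (ZMod p) (GaloisField p n) F
    rw [hKfin, hfin, mul_comm] at this
    exact Nat.eq_of_mul_eq_mul_right (Nat.pos_of_ne_zero hn) this
  have : CharP F p := charP_of_injective_algebraMap (algebraMap (ZMod p) F).injective p
  have hchar : ringChar F ≠ 2 := by rwa [ringChar.eq F p]
  have hφ : ψ.compAddMonoidHom (Algebra.trace (ZMod p) (GaloisField p n)).toAddMonoidHom ≠ 1 := by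
    obtain ⟨y, hy⟩ := AddChar.ne_one_iff.mp hψ
    obtain ⟨x, rfl⟩ := Algebra.trace_surjective (ZMod p) (GaloisField p n) y
    exact AddChar.ne_one_iff.mpr ⟨x, hy⟩
  have h := gaussSum_quadraticChar_of_finrank_eq_two hchar h2 hφ
  rw [hK] at h
  rw [← Nat.cast_pow, ← h]
  congr 1
  ext x
  simp [Algebra.trace_trace]

theorem neg_one_pow_half_pow_add_one {R : Type*} [CommRing R] {p : ℕ} (hp : Odd p) (n : ℕ) :
    (-1 : R) ^ ((p ^ n + 1) / 2) = -(-1) ^ ((p - 1) / 2 * n) := by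
  obtain ⟨k, rfl⟩ := hp
  rw [Nat.add_sub_cancel, Nat.mul_div_cancel_left k two_pos]
  induction n with
  | zero => simp
  | succ n ih =>
    obtain ⟨l, hl⟩ : Odd ((2 * k + 1) ^ n) := Odd.pow ⟨k, rfl⟩
    have e : ((2 * k + 1) ^ (n + 1) + 1) / 2 = (l + 1) + k + 2 * (k * l) := by
      rw [pow_succ, hl, show (2 * l + 1) * (2 * k + 1) + 1 = 2 * ((l + 1) + k + 2 * (k * l)) by ring]
      omega
    have e' : ((2 * k + 1) ^ n + 1) / 2 = l + 1 := by omega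
    rw [e'] at ih
    rw [e, pow_add, pow_add, ih, pow_mul (-1) 2]
    simp [mul_add, pow_add]

/-- Elements of the prime field are squares in an extension of even degree. -/
theorem quadraticChar_algebraMap_zmod_eq_one {p n : ℕ} [Fact p.Prime] (hp : p ≠ 2)
    {F : Type*} [Field F] [Fintype F] [DecidableEq F] [Algebra (ZMod p) F]
    (hF : Fintype.card F = p ^ (2 * n)) {z : ZMod p} (hz : z ≠ 0) :
    quadraticChar F (algebraMap (ZMod p) F z) = 1 := by
  have : CharP F p := charP_of_injective_algebraMap (algebraMap (ZMod p) F).injective p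
  have hchar : ringChar F ≠ 2 := by rwa [ringChar.eq F p]
  have hodd : Odd (p ^ n) := ((Fact.out : p.Prime).odd_of_ne_two hp).pow
  obtain ⟨k, hk⟩ : p - 1 ∣ p ^ n - 1 := by simpa using Nat.sub_dvd_pow_sub_pow p 1 n
  rw [quadraticChar_eq_pow_of_char_ne_two hchar (by simpa using hz), hF, mul_comm 2, pow_mul p,
    hodd.sq_div_two, hk, mul_assoc, pow_mul, ← map_pow, ZMod.pow_card_sub_one_eq_one hz]
  simp

open Finset in
/-- The number of trace-zero elements `x` with `Tr (a x²) = ρ`, expressed by the quadratic Gauss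
sum of the extension. -/
theorem card_trace_eq_zero_and_trace_mul_sq_eq {p n : ℕ} [Fact p.Prime] (hp : p ≠ 2)
    {F R : Type*} [Field F] [Fintype F] [DecidableEq F] [Algebra (ZMod p) F]
    [CommRing R] [IsDomain R] [CharZero R] (hF : Fintype.card F = p ^ (2 * n))
    {ψ : AddChar (ZMod p) R} (hψ : ψ ≠ 1) {a : F} (ha : a ≠ 0)
    (hTr : Algebra.trace (ZMod p) F a⁻¹ ≠ 0) {ρ : ZMod p} (hρ : ρ ≠ 0) :
    (p : R) ^ 2 * #{x : F | Algebra.trace (ZMod p) F x = 0 ∧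
        Algebra.trace (ZMod p) F (a * x ^ 2) = ρ} =
      p ^ (2 * n) + quadraticChar F a *
        gaussSum ((quadraticChar F).ringHomComp (Int.castRingHom R))
          (ψ.compAddMonoidHom (Algebra.trace (ZMod p) F).toAddMonoidHom) *
        quadraticChar (ZMod p) (Algebra.trace (ZMod p) F a⁻¹) * quadraticChar (ZMod p) ρ *
        ((-1) ^ ((p - 1) / 2) * p) := by
  have : CharP F p := charP_of_injective_algebraMap (algebraMap (ZMod p) F).injective p
  have hcharF : ringChar F ≠ 2 := by rwa [ringChar.eq F p]
  have hcharp : ringChar (ZMod p) ≠ 2 := by rwa [ZMod.ringChar_zmod_n]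
  have hprim := AddChar.IsPrimitive.of_ne_one hψ
  set Tr := Algebra.trace (ZMod p) F with hTrdef
  set Ψ := ψ.compAddMonoidHom Tr.toAddMonoidHom with hΨdef
  have hΨapp (x : F) : Ψ x = ψ (Tr x) := rfl
  have hΨ : Ψ ≠ 1 := by
    obtain ⟨y, hy⟩ := AddChar.ne_one_iff.mp hψ
    obtain ⟨x, rfl⟩ := Algebra.trace_surjective (ZMod p) F y
    exact AddChar.ne_one_iff.mpr ⟨x, hy⟩
  set G := gaussSum ((quadraticChar F).ringHomComp (Int.castRingHom R)) Ψ with hG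
  set χ := (quadraticChar (ZMod p)).ringHomComp (Int.castRingHom R) with hχ
  have hχapp (y : ZMod p) : χ y = (quadraticChar (ZMod p) y : R) := rfl
  set g := gaussSum χ ψ with hg
  set T := Tr a⁻¹ with hT
  have hχsq (y : ZMod p) (hy : y ≠ 0) : χ y * χ y = 1 := by
    rw [hχapp, ← Int.cast_mul, ← pow_two, quadraticChar_sq_one hy, Int.cast_one]
  have hχneg : χ (-1) = (-1) ^ ((p - 1) / 2) := by
    have hodd := (Fact.out : p.Prime).odd_of_ne_two hp
    have he : (p - 1) / 2 = p / 2 := by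
      obtain ⟨k, hk⟩ := hodd
      omega
    rw [hχapp, quadraticChar_neg_one hcharp, ZMod.card,
      ZMod.χ₄_eq_neg_one_pow (Nat.odd_iff.mp hodd), he]
    simp
  have hgsq : g ^ 2 = (-1) ^ ((p - 1) / 2) * p := by
    have hne : χ ≠ 1 := (MulChar.ringHomComp_ne_one_iff (Int.castRingHom R).injective_int).mpr
      (quadraticChar_ne_one hcharp)
    rw [hg, gaussSum_sq hne ((quadraticChar_isQuadratic (ZMod p)).comp _) hprim, hχneg, ZMod.card]
  have hcount : (p : R) ^ 2 * #{x : F | Tr x = 0 ∧ Tr (a * x ^ 2) = ρ} =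
      ∑ z, ∑ y, ∑ x, ψ (y * Tr x) * ψ (z * (Tr (a * x ^ 2) - ρ)) := by
    have hx (x : F) : ∑ z, ∑ y, ψ (y * Tr x) * ψ (z * (Tr (a * x ^ 2) - ρ)) =
        if Tr x = 0 ∧ Tr (a * x ^ 2) = ρ then (p : R) ^ 2 else 0 := by
      simp_rw [← sum_mul, ← mul_sum, AddChar.sum_mulShift _ hprim, sub_eq_zero, ZMod.card]
      split_ifs <;> simp_all [pow_two]
    simp_rw [sum_comm (s := univ (α := ZMod p)) (t := univ (α := F)), hx, ← sum_filter]
    rw [sum_const, nsmul_eq_mul, mul_comm]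
  have hzero : ∑ y, ∑ x, ψ (y * Tr x) * ψ (0 * (Tr (a * x ^ 2) - ρ)) = (p : R) ^ (2 * n) := by
    have hy (y : ZMod p) : ∑ x, ψ (y * Tr x) * ψ (0 * (Tr (a * x ^ 2) - ρ)) =
        if y = 0 then (p : R) ^ (2 * n) else 0 := by
      have h := AddChar.sum_mulShift (algebraMap (ZMod p) F y) (AddChar.IsPrimitive.of_ne_one hΨ)
      simpa [hΨapp, mul_comm _ (algebraMap (ZMod p) F y), ← Algebra.smul_def, hF] using h
    simp_rw [hy]
    simp
  have hnz (z : ZMod p) (hz : z ≠ 0) :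
      ∑ y, ∑ x, ψ (y * Tr x) * ψ (z * (Tr (a * x ^ 2) - ρ)) =
        quadraticChar F a * G * (χ (-T) * g) * (χ z * ψ (z * -ρ)) := by
    have hza : algebraMap (ZMod p) F z * a ≠ 0 := mul_ne_zero (by simpa using hz) ha
    have h4 : (4 : ZMod p) = 2 ^ 2 := by norm_num
    have h2 : (2 : ZMod p) ≠ 0 := Ring.two_ne_zero hcharp
    have h4' : (4 : ZMod p) ≠ 0 := h4 ▸ pow_ne_zero 2 h2
    have hy (y : ZMod p) : ∑ x, ψ (y * Tr x) * ψ (z * (Tr (a * x ^ 2) - ρ)) =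
        ψ (z * -ρ) * (quadraticChar F a * G) * ψ (-T / (4 * z) * y ^ 2 + 0 * y) := by
      have h := AddChar.sum_quadratic_eq_gaussSum hcharF hΨ hza (algebraMap (ZMod p) F y)
      have harg : -((algebraMap (ZMod p) F y) ^ 2 / (4 * (algebraMap (ZMod p) F z * a))) =
          (-(y ^ 2 / (4 * z))) • a⁻¹ := by
        rw [Algebra.smul_def]
        simp only [map_neg, map_div₀, map_pow, map_mul, map_ofNat]
        rw [neg_mul, ← mul_assoc, ← div_div, div_eq_mul_inv _ a]
      rw [harg, map_mul, quadraticChar_algebraMap_zmod_eq_one hp hF hz, one_mul, hΨapp, map_smul,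
        smul_eq_mul, ← hT, ← hG] at h
      have e : -T / (4 * z) * y ^ 2 + 0 * y = -(y ^ 2 / (4 * z)) * T := by ring
      rw [e, mul_assoc, mul_comm (_ * G), ← h, mul_sum]
      refine sum_congr rfl fun x _ => ?_
      rw [hΨapp, mul_assoc, ← Algebra.smul_def, ← Algebra.smul_def, map_add, map_smul, map_smul,
        ← AddChar.map_add_eq_mul, ← AddChar.map_add_eq_mul, smul_eq_mul, smul_eq_mul]
      congr 1
      ring
    have hχT : χ (-T / (4 * z)) = χ (-T) * χ z := by
      have e : -T / (4 * z) * (2 * z) ^ 2 = -T * z := by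
        rw [h4]
        field_simp
      rw [← map_mul, ← e, map_mul, pow_two, map_mul, hχsq _ (mul_ne_zero h2 hz), mul_one]
    simp_rw [hy]
    rw [← mul_sum, AddChar.sum_quadratic_eq_gaussSum hcharp hψ
      (div_ne_zero (neg_ne_zero.mpr hTr) (mul_ne_zero h4' hz)), ← hχapp, hχT]
    simp only [← hχ, ← hg]
    rw [zero_pow two_ne_zero, zero_div, neg_zero, AddChar.map_zero_eq_one]
    ring
  have hsumz : ∑ z, χ z * ψ (z * -ρ) = χ (-ρ) * g := by
    have h := gaussSum_mulShift χ ψ (Units.mk0 (-ρ) (neg_ne_zero.mpr hρ))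
    rw [← hg, Units.val_mk0] at h
    rw [← h, ← mul_assoc, hχsq _ (neg_ne_zero.mpr hρ), one_mul]
    simp [gaussSum, mul_comm]
  rw [hcount, ← add_sum_erase _ _ (mem_univ (0 : ZMod p)), hzero,
    sum_congr rfl fun z hz => hnz z (ne_of_mem_erase hz), ← mul_sum,
    sum_erase _ (by rw [hχapp, quadraticChar_zero]; simp), hsumz, ← hgsq, ← hχapp, ← hχapp,
    neg_eq_neg_one_mul T, neg_eq_neg_one_mul ρ, map_mul, map_mul]
  linear_combination (quadraticChar F a * G * χ T * χ ρ * g ^ 2 : R) *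
    hχsq (-1) (neg_ne_zero.mpr one_ne_zero)

theorem stmt_1 (p m : ℕ) [Fact p.Prime] (hp2 : p ≠ 2) (hm : 2 ≤ m) (hmeven : Even m)
    (F : Type) [Field F] [Fintype F] [DecidableEq F] [Algebra (ZMod p) F]
    (hcard : Fintype.card F = p ^ m)
    (a : F) (ha : a ≠ 0) (hTra : Algebra.trace (ZMod p) F a⁻¹ ≠ 0)
    (ρ : ZMod p) (hρ : ρ ≠ 0) :
    (({x : F | x ≠ 0 ∧ Algebra.trace (ZMod p) F x = 0 ∧
        Algebra.trace (ZMod p) F (a * x ^ 2) = ρ}).ncard : ℤ)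
      = (p : ℤ) ^ (m - 2)
        - (-1) ^ (((p - 1) / 2) * ((m + 2) / 2)) * quadraticChar F a
          * quadraticChar (ZMod p) (Algebra.trace (ZMod p) F a⁻¹)
          * quadraticChar (ZMod p) ρ * (p : ℤ) ^ ((m - 2) / 2) := by
  have hp := (Fact.out : p.Prime)
  obtain ⟨n, rfl⟩ : ∃ n, m = 2 * (n + 1) := by
    obtain ⟨k, rfl⟩ := hmeven
    exact ⟨k - 1, by omega⟩
  have hψ : (ZMod.stdAddChar : AddChar (ZMod p) ℂ) ≠ 1 := by
    simpa using ZMod.isPrimitive_stdAddChar p one_ne_zero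
  have hset : {x : F | x ≠ 0 ∧ Algebra.trace (ZMod p) F x = 0 ∧
      Algebra.trace (ZMod p) F (a * x ^ 2) = ρ} =
      (Finset.univ.filter fun x : F => Algebra.trace (ZMod p) F x = 0 ∧
        Algebra.trace (ZMod p) F (a * x ^ 2) = ρ : Finset F) := by
    ext x
    simp only [Set.mem_ofPred_eq, Finset.coe_filter, Finset.mem_univ, true_and,
      and_iff_right_iff_imp]
    rintro ⟨-, h⟩ rfl
    apply hρ
    simpa using h.symm
  have h := card_trace_eq_zero_and_trace_mul_sq_eq hp2 hcard hψ ha hTra hρ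
  rw [gaussSum_quadraticChar_of_card_eq_pow_even hp2 n.succ_ne_zero hcard hψ,
    neg_one_pow_half_pow_add_one (hp.odd_of_ne_two hp2), Nat.succ_eq_add_one] at h
  have e1 : 2 * (n + 1) - 2 = 2 * n := by omega
  have e2 : (2 * (n + 1) + 2) / 2 = n + 1 + 1 := by omega
  have e3 : (2 * n) / 2 = n := by omega
  rw [hset, Set.ncard_coe_finset, e1, e2, e3]
  have hp0 : (p : ℤ) ^ 2 ≠ 0 := pow_ne_zero 2 (by exact_mod_cast hp.ne_zero)
  apply mul_left_cancel₀ hp0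
  apply Int.cast_injective (α := ℂ)
  push_cast
  rw [h]
  ring
end

section
/- Let m be odd. For every a ∈ F_r^* with Tr(a^{-1}) ≠ 0 and every ρ ∈ F_p^*, the number N_a(ρ) of x ∈ F_r^* with Tr(x) = 0 and Tr(ax²) = ρ equals p^{m-2} − (-1)^{((p-1)/2)·((m-1)/2)} · η(a) · η̄(Tr(a^{-1})) · p^{(m-3)/2}. -/
open AddChar Module

/-- The quadratic Gauss sum of a finite field attached to a complex additive character. -/
noncomputable def quadraticGaussSum {K : Type*} [Field K] [Fintype K] [DecidableEq K]
    (ψ : AddChar K ℂ) : ℂ :=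
  gaussSum ((quadraticChar K).ringHomComp (Int.castRingHom ℂ)) ψ

section FiniteField

variable {K : Type*} [Field K] [Fintype K] [DecidableEq K]

theorem quadraticGaussSum_mulShift (ψ : AddChar K ℂ) {c : K} (hc : c ≠ 0) :
    ∑ z, (quadraticChar K z : ℂ) * ψ (c * z) = quadraticChar K c * quadraticGaussSum ψ := by
  have hsq : (quadraticChar K c : ℂ) ^ 2 = 1 := by exact_mod_cast quadraticChar_sq_one hc
  have h := gaussSum_mulShift ((quadraticChar K).ringHomComp (Int.castRingHom ℂ)) ψ
    (Units.mk0 c hc)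
  rw [quadraticGaussSum, ← h]
  simp only [gaussSum, AddChar.mulShift_apply, Units.val_mk0, MulChar.ringHomComp_apply,
    eq_intCast]
  linear_combination (-∑ z, (quadraticChar K z : ℂ) * ψ (c * z)) * hsq

theorem sum_comp_sq (hK : ringChar K ≠ 2) (f : K → ℂ) :
    ∑ x, f (x ^ 2) = ∑ y, (quadraticChar K y + 1 : ℂ) * f y := by
  rw [← Finset.sum_fiberwise (g := fun x : K ↦ x ^ 2) (s := Finset.univ)]
  refine Finset.sum_congr rfl fun y _ ↦ ?_
  have h := quadraticChar_card_sqrts hK y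
  rw [Set.toFinset_ofPred] at h
  rw [Finset.sum_congr rfl (g := fun _ ↦ f y) (by simp +contextual), Finset.sum_const,
    nsmul_eq_mul]
  congr 1
  exact_mod_cast h

theorem sum_addChar_mul_sq (hK : ringChar K ≠ 2) {ψ : AddChar K ℂ} (hψ : ψ.IsPrimitive)
    {c : K} (hc : c ≠ 0) :
    ∑ x, ψ (c * x ^ 2) = quadraticChar K c * quadraticGaussSum ψ := by
  rw [sum_comp_sq hK (fun y ↦ ψ (c * y)), ← quadraticGaussSum_mulShift ψ hc]
  simp only [add_mul, one_mul, Finset.sum_add_distrib]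
  have h : ∑ y, ψ (c * y) = 0 := by
    simpa [hc, mul_comm] using AddChar.sum_mulShift c hψ
  rw [h, add_zero]

theorem sum_addChar_sq_add_linear (hK : ringChar K ≠ 2) {ψ : AddChar K ℂ} (hψ : ψ.IsPrimitive)
    {c : K} (hc : c ≠ 0) (d : K) :
    ∑ x, ψ (c * x ^ 2 + d * x) =
      quadraticChar K c * quadraticGaussSum ψ * ψ (-(d ^ 2 / (4 * c))) := by
  have h2 : (2 : K) ≠ 0 := Ring.two_ne_zero hK
  have h4 : (4 : K) ≠ 0 := by
    rw [show (4 : K) = 2 * 2 by norm_num]; exact mul_ne_zero h2 h2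
  rw [← sum_addChar_mul_sq hK hψ hc, Finset.sum_mul,
    ← Equiv.sum_comp (Equiv.addRight (d / (2 * c))) (fun x ↦ ψ (c * x ^ 2) * _)]
  refine Finset.sum_congr rfl fun x _ ↦ ?_
  rw [← AddChar.map_add_eq_mul]
  congr 1
  simp only [Equiv.coe_addRight]
  field_simp
  ring

theorem quadraticGaussSum_sq (hK : ringChar K ≠ 2) {ψ : AddChar K ℂ} (hψ : ψ.IsPrimitive) :
    quadraticGaussSum ψ ^ 2 = quadraticChar K (-1) * Fintype.card K := by
  have h1 : (quadraticChar K).ringHomComp (Int.castRingHom ℂ) ≠ 1 :=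
    (MulChar.ringHomComp_ne_one_iff (RingHom.injective_int _)).mpr (quadraticChar_ne_one hK)
  rw [quadraticGaussSum, gaussSum_sq h1 ((quadraticChar_isQuadratic K).comp _) hψ]
  simp

end FiniteField

section OddDegree

variable {K L : Type*} [Field K] [Field L] [Algebra K L]

theorem isSquare_algebraMap_iff_of_odd_finrank (hodd : Odd (finrank K L)) (z : K) :
    IsSquare (algebraMap K L z) ↔ IsSquare z := by
  refine ⟨fun ⟨y, hy⟩ ↦ ?_, fun h ↦ h.map _⟩
  rcases eq_or_ne z 0 with rfl | hz
  · exact IsSquare.zero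
  obtain ⟨k, hk⟩ := hodd
  have h : z ^ finrank K L = Algebra.norm K y * Algebra.norm K y := by
    rw [← map_mul, ← hy, Algebra.norm_algebraMap]
  refine ⟨Algebra.norm K y / z ^ k, ?_⟩
  rw [hk] at h
  field_simp
  linear_combination h

variable [Fintype L]

theorem isSquare_algebraMap_discr {ι : Type*} [Fintype ι] [DecidableEq ι] (b : Basis ι K L) :
    IsSquare (algebraMap K L (Algebra.discr K b)) := by
  have hcard : Fintype.card ι = Fintype.card Gal(L/K) := by
    rw [← Module.finrank_eq_card_basis b, ← Nat.card_eq_fintype_card,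
      IsGalois.card_aut_eq_finrank]
  let e := Fintype.equivOfCardEq hcard
  let M : Matrix ι ι L := Matrix.of fun i j ↦ e j (b i)
  refine ⟨M.det, ?_⟩
  nth_rw 2 [← M.det_transpose]
  rw [← Matrix.det_mul, Algebra.discr_def, RingHom.map_det]
  congr 1
  ext i j
  simp only [RingHom.mapMatrix_apply, Matrix.map_apply, Algebra.traceMatrix_apply,
    Algebra.traceForm_apply, trace_eq_sum_automorphisms, Matrix.mul_apply, M, Matrix.of_apply,
    Matrix.transpose_apply, map_mul]
  exact (e.sum_comp (fun σ ↦ σ (b i) * σ (b j))).symm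

variable [Fintype K]

theorem AddChar.IsPrimitive.compTrace {ψ : AddChar K ℂ} (hψ : ψ.IsPrimitive) :
    (ψ.compAddMonoidHom (Algebra.trace K L).toAddMonoidHom).IsPrimitive := by
  refine AddChar.IsPrimitive.of_ne_one fun h ↦ hψ one_ne_zero ?_
  ext t
  obtain ⟨x, rfl⟩ := Algebra.trace_surjective K L t
  simpa using DFunLike.congr_fun h x

variable [DecidableEq K] [DecidableEq L]

theorem quadraticChar_algebraMap_of_odd_finrank (hodd : Odd (finrank K L)) (z : K) :
    quadraticChar L (algebraMap K L z) = quadraticChar K z := by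
  simp only [quadraticChar_apply, quadraticCharFun, isSquare_algebraMap_iff_of_odd_finrank hodd,
    map_eq_zero]

/-- The Hasse–Davenport relation for quadratic Gauss sums in odd degree. -/
theorem quadraticGaussSum_compTrace (hK : ringChar K ≠ 2) (hodd : Odd (finrank K L))
    {ψ : AddChar K ℂ} (hψ : ψ.IsPrimitive) :
    quadraticGaussSum (ψ.compAddMonoidHom (Algebra.trace K L).toAddMonoidHom) =
      quadraticGaussSum ψ ^ finrank K L := by
  have hL : ringChar L ≠ 2 := by
    rwa [← Algebra.ringChar_eq K L]
  let _ : Invertible (2 : K) := invertibleOfNonzero (Ring.two_ne_zero hK)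
  obtain ⟨b, hb⟩ := LinearMap.BilinForm.exists_orthogonal_basis
    (B := Algebra.traceForm K L) (LinearMap.BilinForm.isSymm_iff.mp (Algebra.traceForm_isSymm K))
  have hoff (i j) (hij : i ≠ j) : Algebra.trace K L (b i * b j) = 0 := hb hij
  have hdiscr : Algebra.discr K b = ∏ i, Algebra.trace K L (b i * b i) := by
    rw [Algebra.discr_def, ← Matrix.det_diagonal]
    congr 1
    ext i j
    rcases eq_or_ne i j with rfl | hij
    · simp [Algebra.traceMatrix_apply]
    · simp [Algebra.traceMatrix_apply, hij, hoff]
  have hne := Algebra.discr_not_zero_of_basis K b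
  have hsq : IsSquare (Algebra.discr K b) :=
    (isSquare_algebraMap_iff_of_odd_finrank hodd _).mp (isSquare_algebraMap_discr b)
  have hchar := (quadraticChar_one_iff_isSquare hne).mpr hsq
  rw [hdiscr] at hne hchar
  have htr (c : Fin (finrank K L) → K) : Algebra.trace K L (b.equivFun.symm c ^ 2) =
      ∑ i, Algebra.trace K L (b i * b i) * c i ^ 2 := by
    rw [Basis.equivFun_symm_apply, sq, Finset.sum_mul_sum, map_sum]
    refine Finset.sum_congr rfl fun i _ ↦ ?_
    rw [map_sum, Finset.sum_eq_single i]
    · simp [smul_smul]; ring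
    · intro j _ hij
      simp [hoff i j hij.symm]
    · simp
  have hsum := sum_addChar_mul_sq hL (hψ.compTrace (L := L)) one_ne_zero
  simp only [one_mul, map_one, Int.cast_one] at hsum
  rw [← hsum, ← b.equivFun.symm.toEquiv.sum_comp]
  have hterm (c : Fin (finrank K L) → K) :
      (ψ.compAddMonoidHom (Algebra.trace K L).toAddMonoidHom) (b.equivFun.symm.toEquiv c ^ 2) =
        ∏ i, ψ (Algebra.trace K L (b i * b i) * c i ^ 2) := by
    change ψ (Algebra.trace K L (b.equivFun.symm c ^ 2)) = _
    rw [htr]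
    exact map_prod ψ.toMonoidHom (fun i ↦ Multiplicative.ofAdd _) _
  simp_rw [hterm]
  rw [← Fintype.prod_sum (fun i x ↦ ψ (Algebra.trace K L (b i * b i) * x ^ 2))]
  simp_rw [sum_addChar_mul_sq hK hψ (Finset.prod_ne_zero_iff.mp hne _ (Finset.mem_univ _))]
  rw [Finset.prod_mul_distrib, Finset.prod_const, Finset.card_univ, Fintype.card_fin,
    ← Int.cast_prod, ← map_prod, hchar, Int.cast_one, one_mul]

theorem card_sq_mul_ncard_trace_eq_zero_trace_mul_sq_eq (hK : ringChar K ≠ 2)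
    (hodd : Odd (finrank K L)) {ψ : AddChar K ℂ} (hψ : ψ.IsPrimitive) {a : L} (ha : a ≠ 0)
    (hTra : Algebra.trace K L a⁻¹ ≠ 0) {ρ : K} (hρ : ρ ≠ 0) :
    (Fintype.card K : ℂ) ^ 2 * ({x : L | x ≠ 0 ∧ Algebra.trace K L x = 0 ∧
        Algebra.trace K L (a * x ^ 2) = ρ}).ncard =
      Fintype.card L - quadraticChar L a * quadraticChar K (-Algebra.trace K L a⁻¹) *
        quadraticGaussSum ψ ^ (finrank K L + 1) := by
  have hL : ringChar L ≠ 2 := by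
    rwa [← Algebra.ringChar_eq K L]
  set Ψ := ψ.compAddMonoidHom (Algebra.trace K L).toAddMonoidHom with hΨdef
  have hΨ : Ψ.IsPrimitive := hψ.compTrace
  have hΨapp (x : L) : Ψ x = ψ (Algebra.trace K L x) := rfl
  have hcount : (Fintype.card K : ℂ) ^ 2 * ({x : L | x ≠ 0 ∧ Algebra.trace K L x = 0 ∧
        Algebra.trace K L (a * x ^ 2) = ρ}).ncard =
      ∑ z : K, ∑ y : K, ψ (-(z * ρ)) *
        ∑ x : L, Ψ (algebraMap K L z * a * x ^ 2 + algebraMap K L y * x) := by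
    have hset : {x : L | x ≠ 0 ∧ Algebra.trace K L x = 0 ∧ Algebra.trace K L (a * x ^ 2) = ρ} =
        ↑({x : L | Algebra.trace K L x = 0 ∧
          Algebra.trace K L (a * x ^ 2) - ρ = 0} : Finset L) := by
      ext x
      simp only [Set.mem_ofPred_eq, Finset.coe_filter, Finset.mem_univ, true_and, sub_eq_zero]
      refine ⟨fun h ↦ h.2, fun h ↦ ⟨?_, h⟩⟩
      rintro rfl
      exact hρ (by simpa using h.2.symm)
    rw [hset, Set.ncard_coe_finset, Finset.card_filter, Nat.cast_sum, Finset.mul_sum]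
    simp_rw [Finset.mul_sum]
    simp_rw [Finset.sum_comm (s := (Finset.univ : Finset K)) (t := (Finset.univ : Finset L))]
    refine Finset.sum_congr rfl fun x _ ↦ ?_
    have h1 := AddChar.sum_mulShift (Algebra.trace K L x) hψ
    have h2 := AddChar.sum_mulShift (Algebra.trace K L (a * x ^ 2) - ρ) hψ
    have hprod : ∑ z : K, ∑ y : K, ψ (-(z * ρ)) *
        Ψ (algebraMap K L z * a * x ^ 2 + algebraMap K L y * x) =
        (∑ z, ψ (z * (Algebra.trace K L (a * x ^ 2) - ρ))) *
          ∑ y, ψ (y * Algebra.trace K L x) := by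
      rw [Finset.sum_mul_sum]
      refine Finset.sum_congr rfl fun z _ ↦ Finset.sum_congr rfl fun y _ ↦ ?_
      rw [hΨapp, ← AddChar.map_add_eq_mul, ← AddChar.map_add_eq_mul,
        map_add (Algebra.trace K L), mul_assoc,
        ← Algebra.smul_def, ← Algebra.smul_def, map_smul, map_smul, smul_eq_mul, smul_eq_mul]
      congr 1
      ring
    rw [hprod, h1, h2]
    by_cases hx : Algebra.trace K L x = 0 <;> simp [hx, sq]
  have hzero : ∑ y : K, ψ (-(0 * ρ)) *
      ∑ x : L, Ψ (algebraMap K L 0 * a * x ^ 2 + algebraMap K L y * x) = Fintype.card L := by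
    have h (y : K) := AddChar.sum_mulShift (algebraMap K L y) hΨ
    simp only [map_eq_zero] at h
    simp [mul_comm _ (_ : L), h]
  have hne (z : K) (hz : z ≠ 0) : ∑ y : K, ψ (-(z * ρ)) *
      ∑ x : L, Ψ (algebraMap K L z * a * x ^ 2 + algebraMap K L y * x) =
        ψ (z * -ρ) * (quadraticChar L a * quadraticChar K (-Algebra.trace K L a⁻¹) *
        quadraticGaussSum ψ ^ (finrank K L + 1)) := by
    have hz' : algebraMap K L z ≠ 0 := by simpa using hz
    have h2 : (2 : K) ≠ 0 := Ring.two_ne_zero hK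
    have hlin (y : K) := sum_addChar_sq_add_linear hL hΨ (mul_ne_zero hz' ha) (algebraMap K L y)
    have harg (y : K) : Ψ (-(algebraMap K L y ^ 2 / (4 * (algebraMap K L z * a)))) =
        ψ (-Algebra.trace K L a⁻¹ * z⁻¹ * (2⁻¹) ^ 2 * y ^ 2) := by
      have : -(algebraMap K L y ^ 2 / (4 * (algebraMap K L z * a))) =
          (-(z⁻¹ * (2⁻¹) ^ 2 * y ^ 2)) • a⁻¹ := by
        rw [Algebra.smul_def]
        simp only [map_neg, map_mul, map_pow, map_inv₀, map_ofNat]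
        rw [show (4 : L) = 2 ^ 2 by norm_num]
        field_simp
      rw [hΨapp, this, map_smul, smul_eq_mul]
      congr 1
      ring
    simp_rw [hlin, harg, ← Finset.mul_sum]
    rw [sum_addChar_mul_sq hK hψ (by simp [hTra, hz, h2]), hΨdef,
      quadraticGaussSum_compTrace hK hodd hψ]
    have hzz : quadraticChar K z * quadraticChar K z⁻¹ = 1 := by
      rw [← map_mul, mul_inv_cancel₀ hz, map_one]
    have hzz' : (quadraticChar K z * quadraticChar K z⁻¹ : ℂ) = 1 := by exact_mod_cast hzz
    rw [map_mul, map_mul, map_mul, quadraticChar_sq_one' (inv_ne_zero h2),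
      quadraticChar_algebraMap_of_odd_finrank hodd, mul_neg]
    push_cast
    linear_combination (ψ (-(z * ρ)) * quadraticChar L a *
      quadraticChar K (-Algebra.trace K L a⁻¹) * quadraticGaussSum ψ ^ (finrank K L + 1)) * hzz'
  rw [hcount, ← Finset.add_sum_erase _ _ (Finset.mem_univ (0 : K)), hzero,
    Finset.sum_congr rfl fun z hz ↦ hne z (Finset.ne_of_mem_erase hz), ← Finset.sum_mul]
  have hsum := AddChar.sum_mulShift (-ρ) hψ
  rw [← Finset.add_sum_erase _ _ (Finset.mem_univ (0 : K))] at hsum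
  simp only [zero_mul, AddChar.map_zero_eq_one, neg_eq_zero, hρ, if_false, Nat.cast_zero] at hsum
  linear_combination (quadraticChar L a * quadraticChar K (-Algebra.trace K L a⁻¹) *
    quadraticGaussSum ψ ^ (finrank K L + 1)) * hsum

end OddDegree

theorem stmt_3 (p m : ℕ) [Fact p.Prime] (hp2 : p ≠ 2) (hm : 2 ≤ m) (hmodd : Odd m)
    (F : Type) [Field F] [Fintype F] [DecidableEq F] [Algebra (ZMod p) F]
    (hcard : Fintype.card F = p ^ m)
    (a : F) (ha : a ≠ 0) (hTra : Algebra.trace (ZMod p) F a⁻¹ ≠ 0)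
    (ρ : ZMod p) (hρ : ρ ≠ 0) :
    (({x : F | x ≠ 0 ∧ Algebra.trace (ZMod p) F x = 0 ∧
        Algebra.trace (ZMod p) F (a * x ^ 2) = ρ}).ncard : ℤ)
      = (p : ℤ) ^ (m - 2)
        - (-1) ^ (((p - 1) / 2) * ((m - 1) / 2)) * quadraticChar F a
          * quadraticChar (ZMod p) (Algebra.trace (ZMod p) F a⁻¹)
          * (p : ℤ) ^ ((m - 3) / 2) := by
  have hp : p.Prime := Fact.out
  have hodd2 : p % 2 = 1 := hp.eq_two_or_odd.resolve_left hp2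
  have hK : ringChar (ZMod p) ≠ 2 := by rwa [ZMod.ringChar_zmod_n]
  have hrank : finrank (ZMod p) F = m := by
    have h := Module.card_eq_pow_finrank (K := ZMod p) (V := F)
    rw [hcard, ZMod.card] at h
    exact (Nat.pow_right_injective hp.two_le h).symm
  obtain ⟨k, rfl⟩ : ∃ k, m = 2 * k + 3 := by
    obtain ⟨j, rfl⟩ := hmodd
    exact ⟨j - 1, by omega⟩
  have hψ := ZMod.isPrimitive_stdAddChar p
  have hG := quadraticGaussSum_sq hK hψ
  have h := card_sq_mul_ncard_trace_eq_zero_trace_mul_sq_eq hK (hrank ▸ hmodd) hψ ha hTra hρ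
  have hneg : quadraticChar (ZMod p) (-1) = (-1) ^ ((p - 1) / 2) := by
    rw [quadraticChar_neg_one hK, ZMod.card, ZMod.χ₄_eq_neg_one_pow hodd2]
    congr 1
    omega
  rw [hrank, hcard, ZMod.card, show 2 * k + 3 + 1 = 2 * (k + 2) by ring, pow_mul, hG, ZMod.card,
    neg_eq_neg_one_mul, map_mul] at h
  rw [show 2 * k + 3 - 2 = 2 * k + 1 by omega, show (2 * k + 3 - 1) / 2 = k + 1 by omega,
    show (2 * k + 3 - 3) / 2 = k by omega, pow_mul, ← hneg]
  have hsq : quadraticChar (ZMod p) (-1) ^ 2 = 1 :=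
    quadraticChar_sq_one (neg_ne_zero.mpr one_ne_zero)
  have hp0 : (p : ℤ) ^ 2 ≠ 0 := pow_ne_zero _ (by exact_mod_cast hp.ne_zero)
  apply mul_left_cancel₀ hp0
  norm_cast at h
  push_cast at h
  rw [h]
  linear_combination (-quadraticChar F a * quadraticChar (ZMod p) (Algebra.trace (ZMod p) F a⁻¹) *
    p ^ (k + 2) * quadraticChar (ZMod p) (-1) ^ (k + 1)) * hsq
end

section
/- Let m be even, a ∈ F_r^* with Tr(a^{-1}) ≠ 0, and ρ ∈ F_p^*. Then the triple exponential sum Σ_{z ∈ F_p^*} Σ_{y ∈ F_p} Σ_{x ∈ F_r} ζ_p^{Tr(azx² + yx) − zρ} equals −(-1)^{((p-1)/2)·((m+2)/2)} · η(a) · η̄(Tr(a^{-1})) · η̄(ρ) · p^{(m+2)/2} (as a complex number). -/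
/-- `ζ_p ^ c` for `c ∈ F_p`: `exp(2πi·c̃/p)` where `c̃` is the integer representative. -/
noncomputable def zetaP (p : ℕ) (c : ZMod p) : ℂ :=
  Complex.exp (2 * Real.pi * Complex.I * (c.val : ℂ) / (p : ℂ))

open AddChar in
/-- The sum `∑ ψ(b x²)` as a multiple of the quadratic Gauss sum. -/
theorem sum_addChar_mul_sq_s5 {F : Type*} [Field F] [Fintype F] [DecidableEq F]
    (hF : ringChar F ≠ 2) {ψ : AddChar F ℂ} (hψ : ψ ≠ 1) {b : F} (hb : b ≠ 0) :
    ∑ x, ψ (b * x ^ 2) =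
      (quadraticChar F b : ℂ) *
        gaussSum ((quadraticChar F).ringHomComp (Int.castRingHom ℂ)) ψ := by
  have hcount (t : F) :
      ∑ x with x ^ 2 = t, ψ (b * x ^ 2) = ((quadraticChar F t : ℂ) + 1) * ψ (b * t) := by
    rw [Finset.sum_congr rfl (g := fun _ => ψ (b * t))
      (fun x hx => by rw [(Finset.mem_filter.mp hx).2]), Finset.sum_const, nsmul_eq_mul]
    congr 1
    have h := quadraticChar_card_sqrts hF t
    have h' : {x : F | x ^ 2 = t}.toFinset = Finset.univ.filter (fun x => x ^ 2 = t) := by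
      ext; simp
    rw [h'] at h
    exact_mod_cast congrArg (Int.cast : ℤ → ℂ) h
  have hsum : ∑ t, ψ (b * t) = 0 := by
    simpa [mul_comm, hb] using sum_mulShift b (IsPrimitive.of_ne_one hψ)
  have hshift := gaussSum_mulShift ((quadraticChar F).ringHomComp (Int.castRingHom ℂ)) ψ
    (Units.mk0 b hb)
  have hsq : (quadraticChar F b : ℂ) * quadraticChar F b = 1 := by
    have := quadraticChar_sq_one hb
    rw [sq] at this
    exact_mod_cast congrArg (Int.cast : ℤ → ℂ) this
  rw [← Finset.sum_fiberwise Finset.univ (fun x : F => x ^ 2)]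
  simp_rw [hcount, add_mul, one_mul]
  rw [Finset.sum_add_distrib, hsum, add_zero, ← hshift, ← mul_assoc]
  simp only [gaussSum, mulShift_apply, MulChar.ringHomComp_apply, eq_intCast, Units.val_mk0, hsq,
    one_mul]

/-- The quadratic character of `𝔽_{q²}` at `t` with `t ^ q = ε t`, where `ε = ±1`. -/
theorem quadraticChar_of_pow_eq {F : Type*} [Field F] [Fintype F] [DecidableEq F]
    (hF : ringChar F ≠ 2) {q : ℕ} (hcard : Fintype.card F = q ^ 2) (ε : ℤˣ) {t : F}
    (ht : t ≠ 0) (h : t ^ q = ((ε : ℤ) : F) * t) :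
    quadraticChar F t = (ε : ℤ) ^ ((q + 1) / 2) := by
  have hodd : q % 2 = 1 := by
    have := FiniteField.odd_card_of_char_ne_two hF
    rw [hcard, Nat.pow_mod] at this
    rcases Nat.mod_two_eq_zero_or_one q with h0 | h1
    · simp [h0] at this
    · exact h1
  obtain ⟨n, rfl⟩ : ∃ n, q = 2 * n + 1 := ⟨q / 2, by omega⟩
  have hpow : t ^ (2 * n) = ((ε : ℤ) : F) := by
    rw [pow_succ] at h
    exact mul_right_cancel₀ ht h
  have hhalf : Fintype.card F / 2 = 2 * n * (n + 1) := by
    rw [hcard, show (2 * n + 1) ^ 2 = 2 * (2 * n * (n + 1)) + 1 by ring]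
    omega
  have hexp : (2 * n + 1 + 1) / 2 = n + 1 := by omega
  have hq := quadraticChar_eq_pow_of_char_ne_two' hF t
  rw [hhalf, pow_mul, hpow] at hq
  rw [hexp]
  have hε : (ε : ℤ) ^ (n + 1) = 1 ∨ (ε : ℤ) ^ (n + 1) = -1 := by
    rw [← Units.val_pow_eq_pow_val]
    rcases Int.units_eq_one_or (ε ^ (n + 1)) with h | h <;> simp [h]
  have h2 := Ring.two_ne_zero hF
  have hne : (1 : F) ≠ -1 := fun h => h2 (by linear_combination h)
  have hq' : (quadraticChar F t : F) = (((ε : ℤ) ^ (n + 1) : ℤ) : F) := by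
    rw [hq]; push_cast; rfl
  rcases quadraticChar_dichotomy ht with h1 | h1 <;> rcases hε with h3 | h3 <;>
    rw [h1, h3] at hq' ⊢ <;> push_cast at hq'
  · exact absurd hq' hne
  · exact absurd hq'.symm hne

open AddChar in
/-- The quadratic Gauss sum over `𝔽_{q²}` for a Frobenius-invariant additive character. -/
theorem gaussSum_quadraticChar_of_card_eq_sq {F : Type*} [Field F] [Fintype F] [DecidableEq F]
    {p k : ℕ} [Fact p.Prime] [CharP F p] (hp2 : p ≠ 2) (hcard : Fintype.card F = (p ^ k) ^ 2)
    {ψ : AddChar F ℂ} (hψ : ψ ≠ 1) (hfrob : ∀ x, ψ (x ^ p ^ k) = ψ x) :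
    gaussSum ((quadraticChar F).ringHomComp (Int.castRingHom ℂ)) ψ =
      (-1) ^ ((p ^ k + 1) / 2) * (p : ℂ) ^ k := by
  classical
  have hF : ringChar F ≠ 2 := by rwa [ringChar.eq F p]
  have h2 : (2 : F) ≠ 0 := Ring.two_ne_zero hF
  set K : Subfield F := (iterateFrobenius F p k).eqLocusField (RingHom.id F) with hK
  have mem_K (x : F) : x ∈ K ↔ x ^ p ^ k = x := by
    rw [hK]; exact Iff.rfl
  have hKpow (c : K) : (c : F) ^ p ^ k = c := (mem_K _).mp c.2
  have hcard_odd : p ^ k % 2 = 1 :=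
    Nat.odd_iff.mp (((Fact.out : p.Prime).odd_of_ne_two hp2).pow)
  obtain ⟨t, ht0, ht⟩ : ∃ t : F, t ≠ 0 ∧ t ^ p ^ k = -t := by
    obtain ⟨s, hs⟩ := quadraticChar_exists_neg_one hF
    have hs0 : s ≠ 0 := by rintro rfl; simp at hs
    obtain ⟨n, hn⟩ : ∃ n, p ^ k = 2 * n + 1 := ⟨p ^ k / 2, by omega⟩
    refine ⟨s ^ (n + 1), pow_ne_zero _ hs0, ?_⟩
    have hq := quadraticChar_eq_pow_of_char_ne_two' hF s
    rw [hs, hcard, hn, show (2 * n + 1) ^ 2 / 2 = (n + 1) * (2 * n) by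
      rw [show (2 * n + 1) ^ 2 = 2 * ((n + 1) * (2 * n)) + 1 by ring]; omega, pow_mul] at hq
    rw [hn, pow_succ, ← hq]
    push_cast; ring
  -- `F = K ⊕ K t`
  have hbij : Function.Bijective (fun w : K × K => (w.1 : F) + w.2 * t) := by
    constructor
    · rintro ⟨u, v⟩ ⟨u', v'⟩ h
      have h1 : (u : F) + v * t = u' + v' * t := h
      have h3 : ((u : F) + v * t) ^ p ^ k = (u' + v' * t) ^ p ^ k := by rw [h1]
      simp only [add_pow_char_pow, mul_pow, hKpow, ht] at h3
      have hu : (u : F) = u' := mul_left_cancel₀ h2 (by linear_combination h1 + h3)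
      have hv : (v : F) = v' := mul_right_cancel₀ ht0 (by linear_combination h1 - hu)
      exact Prod.ext (Subtype.ext hu) (Subtype.ext hv)
    · intro x
      have hxx : (x ^ p ^ k) ^ p ^ k = x := by
        rw [← pow_mul, ← sq, ← hcard, FiniteField.pow_card]
      have h2pow : (2 : F) ^ p ^ k = 2 := (mem_K 2).mp (ofNat_mem K 2)
      refine ⟨⟨⟨(x + x ^ p ^ k) / 2, ?_⟩, ⟨(x - x ^ p ^ k) / (2 * t), ?_⟩⟩, ?_⟩
      · rw [mem_K, div_pow, add_pow_char_pow, hxx, h2pow, add_comm]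
      · rw [mem_K, div_pow, sub_pow_char_pow, hxx, mul_pow, h2pow, ht]
        field_simp; ring
      · field_simp; ring
  have hcardK : Fintype.card K = p ^ k := by
    have h := Fintype.card_of_bijective hbij
    rw [Fintype.card_prod, hcard, ← sq] at h
    exact Nat.pow_left_injective two_ne_zero h
  have h2K : (2 : K) ≠ 0 := fun h => h2 (congrArg Subtype.val h)
  -- `ψ` is trivial on `K t`
  have hψt (c : K) : ψ (c * t) = 1 := by
    have h (d : K) : ψ (-(d * t)) = ψ (d * t) := by
      rw [← hfrob (d * t), mul_pow, hKpow, ht, mul_neg]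
    have hd := h (c / 2)
    have hsplit : (c : F) * t = ((c / 2 : K) : F) * t - -(((c / 2 : K) : F) * t) := by
      rw [sub_neg_eq_add, ← add_mul, ← AddMemClass.coe_add, ← two_mul, mul_div_cancel₀ _ h2K]
    rw [hsplit, sub_eq_add_neg, neg_neg, map_add_eq_mul]
    nth_rw 1 [← hd]
    rw [← map_add_eq_mul, neg_add_cancel, map_zero_eq_one]
  let ψK : AddChar K ℂ := ψ.compAddMonoidHom K.subtype.toAddMonoidHom
  have hψK_apply (c : K) : ψK c = ψ c := rfl
  have hψK : ψK ≠ 1 := by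
    intro h
    refine hψ (DFunLike.ext _ _ fun x => ?_)
    obtain ⟨⟨u, v⟩, rfl⟩ := hbij.2 x
    simp only [map_add_eq_mul, hψt, ← hψK_apply, h, AddChar.one_apply, mul_one]
  have hinner (w : K × K) :
      ∑ c : K, ψ (c * (w.1 + w.2 * t)) = if w.1 = 0 then (p : ℂ) ^ k else 0 := by
    have h := sum_mulShift w.1 (IsPrimitive.of_ne_one hψK)
    rw [hcardK] at h
    push_cast at h
    rw [← h]
    refine Finset.sum_congr rfl fun c _ => ?_
    rw [hψK_apply, mul_add, map_add_eq_mul, ← mul_assoc]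
    have := hψt (c * w.2)
    push_cast at this ⊢
    rw [this, mul_one]
  have hηK (c : K) (hc : c ≠ 0) : quadraticChar F (c : F) = 1 := by
    have h := quadraticChar_of_pow_eq hF hcard 1 (t := (c : F)) (by simpa using hc)
      (by simp [hKpow])
    simpa using h
  have hηt : quadraticChar F t = (-1) ^ ((p ^ k + 1) / 2) := by
    have h := quadraticChar_of_pow_eq hF hcard (-1) ht0 (by simp [ht])
    simpa using h
  set χ := (quadraticChar F).ringHomComp (Int.castRingHom ℂ) with hχ
  have hχ_apply (x : F) : χ x = (quadraticChar F x : ℂ) := rfl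
  have hχ1 : χ ≠ 1 := (MulChar.ringHomComp_ne_one_iff (RingHom.injective_int _)).mpr
    (quadraticChar_ne_one hF)
  have hcount : ∑ c : K, (if c = 0 then (0 : ℂ) else 1) = (p : ℂ) ^ k - 1 := by
    have h : ∀ c : K, (if c = 0 then (0 : ℂ) else 1) = 1 - if c = 0 then 1 else 0 := by
      intro c; split_ifs <;> simp
    simp_rw [h, Finset.sum_sub_distrib]
    simp [hcardK]
  have hleft : ∑ c : K, ∑ x, χ x * ψ (c * x) = ((p : ℂ) ^ k - 1) * gaussSum χ ψ := by
    rw [← hcount, Finset.sum_mul]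
    refine Finset.sum_congr rfl fun c _ => ?_
    split_ifs with hc
    · simp [hc, MulChar.sum_eq_zero_of_ne_one hχ1]
    · have hc' : (c : F) ≠ 0 := by simpa using hc
      have h := gaussSum_mulShift χ ψ (Units.mk0 (c : F) hc')
      rw [Units.val_mk0, hχ_apply, hηK c hc, Int.cast_one, one_mul] at h
      rw [one_mul, ← h]
      simp [gaussSum, mulShift_apply]
  have hright : ∑ c : K, ∑ x, χ x * ψ (c * x) =
      ((p : ℂ) ^ k - 1) * ((-1) ^ ((p ^ k + 1) / 2) * (p : ℂ) ^ k) := by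
    rw [Finset.sum_comm]
    simp_rw [← Finset.mul_sum]
    rw [← Fintype.sum_bijective _ hbij (fun w => χ (w.1 + w.2 * t) *
      ∑ c : K, ψ (c * (w.1 + w.2 * t))) _ (fun _ => rfl)]
    simp_rw [hinner]
    rw [Fintype.sum_prod_type_right, ← hcount, Finset.sum_mul]
    refine Finset.sum_congr rfl fun v _ => ?_
    simp only [mul_ite, mul_zero, Finset.sum_ite_eq', Finset.mem_univ, if_true,
      ZeroMemClass.coe_zero, zero_add, map_mul]
    split_ifs with hv
    · rw [hv, ZeroMemClass.coe_zero, MulChar.map_zero, zero_mul, zero_mul, zero_mul]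
    · rw [hχ_apply, hχ_apply, hηK v hv, hηt]
      push_cast; ring
  have hne : (p : ℂ) ^ k - 1 ≠ 0 := by
    have hlt : 1 < Fintype.card K := Fintype.one_lt_card
    rw [hcardK] at hlt
    rw [sub_ne_zero]
    exact_mod_cast hlt.ne'
  exact mul_left_cancel₀ hne (hleft.symm.trans hright)

theorem trace_pow_prime_pow {F : Type*} [Field F] [Fintype F] {p : ℕ} [Fact p.Prime]
    [Algebra (ZMod p) F] (k : ℕ) (x : F) :
    Algebra.trace (ZMod p) F (x ^ p ^ k) = Algebra.trace (ZMod p) F x := by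
  induction k with
  | zero => simp
  | succ k ih =>
    rw [← ih, pow_succ, pow_mul]
    have h := Algebra.trace_eq_of_algEquiv
      (FiniteField.frobeniusAlgEquivOfAlgebraic (ZMod p) F) (x ^ p ^ k)
    simpa [ZMod.card] using h

theorem zetaP_eq_stdAddChar {p : ℕ} [NeZero p] (c : ZMod p) :
    zetaP p c = ZMod.stdAddChar c := by
  rw [ZMod.stdAddChar_apply, ZMod.toCircle_apply]
  rfl

/-- Completing the square in a quadratic exponential sum. -/
theorem sum_addChar_mul_sq_add_mul {F : Type*} [Field F] [Fintype F] (h2 : (2 : F) ≠ 0)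
    (ψ : AddChar F ℂ) {b : F} (hb : b ≠ 0) (y : F) :
    ∑ x, ψ (b * x ^ 2 + y * x) = ψ (-(y ^ 2 / (4 * b))) * ∑ x, ψ (b * x ^ 2) := by
  have h4 : (4 : F) ≠ 0 := by
    rw [show (4 : F) = 2 * 2 by norm_num]; exact mul_ne_zero h2 h2
  rw [Finset.mul_sum, ← Equiv.sum_comp (Equiv.subRight (y / (2 * b)))]
  refine Finset.sum_congr rfl fun x _ => ?_
  rw [← AddChar.map_add_eq_mul]
  congr 1
  simp only [Equiv.subRight_apply]
  field_simp
  ring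

theorem stmt_5 (p m : ℕ) [Fact p.Prime] (hp2 : p ≠ 2) (hm : 2 ≤ m) (hmeven : Even m)
    (F : Type) [Field F] [Fintype F] [DecidableEq F] [Algebra (ZMod p) F]
    (hcard : Fintype.card F = p ^ m)
    (a : F) (ha : a ≠ 0) (hTra : Algebra.trace (ZMod p) F a⁻¹ ≠ 0)
    (ρ : ZMod p) (hρ : ρ ≠ 0) :
    (∑ z ∈ Finset.univ.filter (fun z : ZMod p => z ≠ 0), ∑ y : ZMod p, ∑ x : F,
        zetaP p (Algebra.trace (ZMod p) F
          (a * algebraMap (ZMod p) F z * x ^ 2 + algebraMap (ZMod p) F y * x) - z * ρ))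
      = ((-((-1) ^ (((p - 1) / 2) * ((m + 2) / 2))) * quadraticChar F a
          * quadraticChar (ZMod p) (Algebra.trace (ZMod p) F a⁻¹)
          * quadraticChar (ZMod p) ρ * (p : ℤ) ^ ((m + 2) / 2) : ℤ) : ℂ) := by
  obtain ⟨k, hk⟩ := hmeven
  have hcard' : Fintype.card F = (p ^ k) ^ 2 := by rw [hcard, hk, ← pow_mul, mul_two]
  have hchar : CharP F p := charP_of_injective_algebraMap (algebraMap (ZMod p) F).injective p
  have hF : ringChar F ≠ 2 := by rwa [ringChar.eq F p]
  have hFp : ringChar (ZMod p) ≠ 2 := by rwa [ZMod.ringChar_zmod_n]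
  have h2F : (2 : F) ≠ 0 := Ring.two_ne_zero hF
  have h2 : (2 : ZMod p) ≠ 0 := Ring.two_ne_zero hFp
  set T := Algebra.trace (ZMod p) F a⁻¹ with hT
  let φ : AddChar (ZMod p) ℂ := ZMod.stdAddChar
  let ψ : AddChar F ℂ := φ.compAddMonoidHom (Algebra.trace (ZMod p) F).toAddMonoidHom
  have hψ_apply (x : F) : ψ x = φ (Algebra.trace (ZMod p) F x) := rfl
  have hφ : φ ≠ 1 := fun h => ZMod.isPrimitive_stdAddChar p one_ne_zero (by
    ext x; simpa [AddChar.mulShift_apply] using DFunLike.congr_fun h x)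
  have hψ : ψ ≠ 1 := by
    intro h
    refine hφ (DFunLike.ext _ _ fun c => ?_)
    have hc := DFunLike.congr_fun h (algebraMap (ZMod p) F (c / T) * a⁻¹)
    rwa [hψ_apply, ← Algebra.smul_def, map_smul, smul_eq_mul, ← hT, div_mul_cancel₀ _ hTra] at hc
  set G := gaussSum ((quadraticChar F).ringHomComp (Int.castRingHom ℂ)) ψ
  set g := gaussSum ((quadraticChar (ZMod p)).ringHomComp (Int.castRingHom ℂ)) φ with hgdef
  have hG : G = (-1) ^ ((p ^ k + 1) / 2) * (p : ℂ) ^ k :=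
    gaussSum_quadraticChar_of_card_eq_sq hp2 hcard' hψ
      (fun x => by rw [hψ_apply, trace_pow_prime_pow, hψ_apply])
  have hg : g ^ 2 = (quadraticChar (ZMod p) (-1) : ℂ) * p := by
    have h := gaussSum_sq ((MulChar.ringHomComp_ne_one_iff (RingHom.injective_int _)).mpr
      (quadraticChar_ne_one hFp)) ((quadraticChar_isQuadratic (ZMod p)).comp (Int.castRingHom ℂ))
      (AddChar.IsPrimitive.of_ne_one hφ)
    rwa [ZMod.card] at h
  have hηz (z : ZMod p) (hz : z ≠ 0) : quadraticChar F (algebraMap (ZMod p) F z) = 1 := by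
    have h := quadraticChar_of_pow_eq hF hcard' 1 (t := algebraMap (ZMod p) F z)
      (by simpa using hz) (by simp [← map_pow, ZMod.pow_card_pow])
    simpa using h
  have hinner (z : ZMod p) (hz : z ≠ 0) :
      ∑ y : ZMod p, ∑ x : F, zetaP p (Algebra.trace (ZMod p) F
          (a * algebraMap (ZMod p) F z * x ^ 2 + algebraMap (ZMod p) F y * x) - z * ρ) =
        (quadraticChar F a : ℂ) * quadraticChar (ZMod p) (-T) * G * g *
          ((quadraticChar (ZMod p) z : ℂ) * φ (z * -ρ)) := by
    have hz' : algebraMap (ZMod p) F z ≠ 0 := by simpa using hz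
    have hb : a * algebraMap (ZMod p) F z ≠ 0 := mul_ne_zero ha hz'
    have h4 : (4 : ZMod p) = 2 ^ 2 := by norm_num
    have hc : -T / (4 * z) ≠ 0 := by
      rw [h4]
      exact div_ne_zero (neg_ne_zero.mpr hTra) (mul_ne_zero (pow_ne_zero _ h2) hz)
    have htrace (y : ZMod p) : Algebra.trace (ZMod p) F
        (-((algebraMap (ZMod p) F y) ^ 2 / (4 * (a * algebraMap (ZMod p) F z)))) =
          -T / (4 * z) * y ^ 2 := by
      have h : -((algebraMap (ZMod p) F y) ^ 2 / (4 * (a * algebraMap (ZMod p) F z))) =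
          (-(y ^ 2 / (4 * z))) • a⁻¹ := by
        rw [Algebra.smul_def]
        simp only [map_neg, map_div₀, map_pow, map_mul, map_ofNat]
        field_simp
      rw [h, map_smul, smul_eq_mul, ← hT]
      ring
    have hηc : quadraticChar (ZMod p) (-T / (4 * z)) =
        quadraticChar (ZMod p) (-T) * quadraticChar (ZMod p) z := by
      have h : -T / (4 * z) = -T * z * ((2 * z)⁻¹) ^ 2 := by
        rw [h4]; field_simp
      rw [h, map_mul, map_mul, quadraticChar_sq_one' (inv_ne_zero (mul_ne_zero h2 hz)), mul_one]
    have hx (y : ZMod p) : ∑ x : F, zetaP p (Algebra.trace (ZMod p) F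
          (a * algebraMap (ZMod p) F z * x ^ 2 + algebraMap (ZMod p) F y * x) - z * ρ) =
        φ (-T / (4 * z) * y ^ 2) * ((quadraticChar F a : ℂ) * G * φ (z * -ρ)) := by
      calc _ = ∑ x : F, ψ (a * algebraMap (ZMod p) F z * x ^ 2 + algebraMap (ZMod p) F y * x) *
            φ (z * -ρ) := by
            refine Finset.sum_congr rfl fun x _ => ?_
            rw [zetaP_eq_stdAddChar, sub_eq_add_neg, ← mul_neg, AddChar.map_add_eq_mul,
              hψ_apply]
        _ = _ := by
            rw [← Finset.sum_mul, sum_addChar_mul_sq_add_mul h2F ψ hb, sum_addChar_mul_sq_s5 hF hψ hb,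
              hψ_apply, htrace,
              map_mul (quadraticChar F), hηz z hz, mul_one]
            ring
    simp_rw [hx]
    rw [← Finset.sum_mul, sum_addChar_mul_sq_s5 hFp hφ hc, hηc]
    push_cast
    ring
  have houter : ∑ z ∈ Finset.univ.filter (fun z : ZMod p => z ≠ 0),
      ((quadraticChar (ZMod p) z : ℂ) * φ (z * -ρ)) = (quadraticChar (ZMod p) (-ρ) : ℂ) * g := by
    have hρ' : -ρ ≠ 0 := neg_ne_zero.mpr hρ
    have h := gaussSum_mulShift ((quadraticChar (ZMod p)).ringHomComp (Int.castRingHom ℂ)) φ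
      (Units.mk0 (-ρ) hρ')
    have hsq : (quadraticChar (ZMod p) (-ρ) : ℂ) * quadraticChar (ZMod p) (-ρ) = 1 := by
      have := quadraticChar_sq_one hρ'
      rw [sq] at this
      exact_mod_cast congrArg (Int.cast : ℤ → ℂ) this
    rw [hgdef, ← h, ← mul_assoc]
    simp only [Units.val_mk0, MulChar.ringHomComp_apply, eq_intCast, hsq, one_mul]
    rw [Finset.sum_filter_of_ne (by rintro z _ hz rfl; simp at hz)]
    simp [gaussSum, AddChar.mulShift_apply, mul_comm]
  rw [Finset.sum_congr rfl fun z hz => hinner z (Finset.mem_filter.mp hz).2, ← Finset.mul_sum,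
    houter]
  have hp_odd : p % 2 = 1 := Nat.odd_iff.mp ((Fact.out : p.Prime).odd_of_ne_two hp2)
  have hneg : quadraticChar (ZMod p) (-1) = (-1) ^ (p / 2) := by
    rw [quadraticChar_neg_one hFp, ZMod.card, ZMod.χ₄_eq_neg_one_pow hp_odd]
  have hsign : ((-1) ^ ((p ^ k + 1) / 2) : ℤ) = -((-1) ^ (p / 2)) ^ k := by
    have hq_odd : p ^ k % 2 = 1 := by simp [Nat.pow_mod, hp_odd]
    rw [show (p ^ k + 1) / 2 = p ^ k / 2 + 1 by omega, pow_succ,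
      ← ZMod.χ₄_eq_neg_one_pow hq_odd, ← ZMod.χ₄_eq_neg_one_pow hp_odd]
    push_cast
    rw [map_pow]
    ring
  have hsignC : ((-1) ^ ((p ^ k + 1) / 2) : ℂ) = -((-1) ^ (p / 2)) ^ k := by
    exact_mod_cast congrArg (Int.cast : ℤ → ℂ) hsign
  have hneg_mul (x : ZMod p) :
      quadraticChar (ZMod p) (-x) = (-1) ^ (p / 2) * quadraticChar (ZMod p) x := by
    rw [← neg_one_mul, map_mul, hneg]
  have hsq : (((-1) ^ (p / 2)) ^ 2 : ℂ) = 1 := by rw [← pow_mul, mul_comm, pow_mul]; simp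
  rw [hneg] at hg
  rw [hG, hsignC, hneg_mul, hneg_mul, show (m + 2) / 2 = k + 1 by omega,
    show (p - 1) / 2 = p / 2 by omega, pow_mul]
  push_cast at hg ⊢
  generalize ((-1 : ℂ) ^ (p / 2)) = s at *
  linear_combination (-(quadraticChar F a : ℂ) * quadraticChar (ZMod p) T *
    quadraticChar (ZMod p) ρ * s ^ k * (p : ℂ) ^ k) * (s ^ 2 * hg + s * p * hsq)
end
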